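/- Let p ∈ [1,∞) and for each n let X^{(n)} ~ ν_p^n. Then the sequence (‖X^{(n)}‖_p)_{n} satisfies a large deviation principle with speed n and good rate function I_1(x) = −log x for x ∈ (0,1] and I_1(x) = +∞ otherwise; that is, for every Borel set A ⊆ ℝ, −inf_{x ∈ int(A)} I_1(x) ≤ liminf_{n→∞} n^{−1} log ℙ(‖X^{(n)}‖_p ∈ A) ≤ limsup_{n→∞} n^{−1} log ℙ(‖X^{(n)}‖_p ∈ A) ≤ −inf_{x ∈ cl(A)} I_1(x). -/

import Mathlib

open MeasureTheory Set Filter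
open scoped ENNReal NNReal Topology

/-- The `p`-norm on `ℝ^n`. -/
noncomputable def pnorm {n : ℕ} (p : ℝ) (x : Fin n → ℝ) : ℝ :=
  (∑ i, |x i| ^ p) ^ (1 / p)

/-- The unit ball `𝔹_p^n`. -/
def pBall (n : ℕ) (p : ℝ) : Set (Fin n → ℝ) := {x | pnorm p x ≤ 1}

/-- The uniform probability measure `ν_p^n` on `𝔹_p^n`. -/
noncomputable def nuMeasure (n : ℕ) (p : ℝ) : Measure (Fin n → ℝ) :=
  (volume (pBall n p))⁻¹ • volume.restrict (pBall n p)

/-- A sequence of distributions `μ_n` on `ℝ` satisfies a large deviation principle with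
speed `s(n)` and good rate function `I` if `I` has compact sublevel sets and for every
Borel set `A`,
`−inf_{int A} I ≤ liminf s(n)⁻¹ log μ_n(A) ≤ limsup s(n)⁻¹ log μ_n(A) ≤ −inf_{cl A} I`. -/
def IsLDP (μ : ℕ → Measure ℝ) (s : ℕ → ℝ) (I : ℝ → ℝ≥0∞) : Prop :=
  (∀ c : ℝ≥0, IsCompact {x : ℝ | I x ≤ (c : ℝ≥0∞)}) ∧
  ∀ A : Set ℝ, MeasurableSet A →
    (-(((⨅ x ∈ interior A, I x) : ℝ≥0∞) : EReal) ≤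
        liminf (fun n => (((s n)⁻¹ : ℝ) : EReal) * ENNReal.log (μ n A)) atTop ∧
      limsup (fun n => (((s n)⁻¹ : ℝ) : EReal) * ENNReal.log (μ n A)) atTop ≤
        -(((⨅ x ∈ closure A, I x) : ℝ≥0∞) : EReal))

/-- The law of `‖X‖_p` under the uniform distribution on `𝔹_p^n`. -/
noncomputable def pnormLaw (n : ℕ) (p : ℝ) : Measure ℝ :=
  Measure.map (fun x : Fin n → ℝ => pnorm p x) (nuMeasure n p)

lemma measurable_pnorm (n : ℕ) (p : ℝ) : Measurable (fun x : Fin n → ℝ => pnorm p x) := by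
  unfold pnorm
  fun_prop

lemma pnormLaw_apply (n : ℕ) (p : ℝ) {A : Set ℝ} (hA : MeasurableSet A) :
    pnormLaw n p A =
      (volume (pBall n p))⁻¹ * volume {x : Fin n → ℝ | pnorm p x ∈ A ∧ pnorm p x ≤ 1} := by
  rw [pnormLaw, Measure.map_apply (measurable_pnorm n p) hA, nuMeasure, Measure.smul_apply,
    smul_eq_mul, Measure.restrict_apply (measurable_pnorm n p hA)]
  rfl

lemma volume_pBall_ne_zero {n : ℕ} (hn : n ≠ 0) {p : ℝ} (hp : 1 ≤ p) :
    volume (pBall n p) ≠ 0 := by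
  have : Nonempty (Fin n) := ⟨⟨0, Nat.pos_of_ne_zero hn⟩⟩
  have h := MeasureTheory.volume_sum_rpow_le (Fin n) hp 1
  simp only [pBall, pnorm]
  rw [h]
  have h1 : 0 < Real.Gamma (1 / p + 1) := Real.Gamma_pos_of_pos (by positivity)
  have h2 : 0 < Real.Gamma (Fintype.card (Fin n) / p + 1) :=
    Real.Gamma_pos_of_pos (by positivity)
  simp only [ENNReal.ofReal_one, one_pow, one_mul, ne_eq, ENNReal.ofReal_eq_zero, not_le]
  positivity

lemma volume_pBall_ne_top {n : ℕ} (hn : n ≠ 0) {p : ℝ} (hp : 1 ≤ p) :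
    volume (pBall n p) ≠ ⊤ := by
  have : Nonempty (Fin n) := ⟨⟨0, Nat.pos_of_ne_zero hn⟩⟩
  have h := MeasureTheory.volume_sum_rpow_le (Fin n) hp 1
  simp only [pBall, pnorm]
  rw [h]
  finiteness

lemma volume_pnorm_le {n : ℕ} (hn : n ≠ 0) {p : ℝ} (hp : 1 ≤ p) (r : ℝ) :
    volume {x : Fin n → ℝ | pnorm p x ≤ r} = ENNReal.ofReal r ^ n * volume (pBall n p) := by
  have : Nonempty (Fin n) := ⟨⟨0, Nat.pos_of_ne_zero hn⟩⟩
  simp only [pBall, pnorm]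
  rw [MeasureTheory.volume_sum_rpow_le (Fin n) hp, MeasureTheory.volume_sum_rpow_le (Fin n) hp]
  simp

lemma volume_pnorm_lt {n : ℕ} (hn : n ≠ 0) {p : ℝ} (hp : 1 ≤ p) (r : ℝ) :
    volume {x : Fin n → ℝ | pnorm p x < r} = ENNReal.ofReal r ^ n * volume (pBall n p) := by
  have : Nonempty (Fin n) := ⟨⟨0, Nat.pos_of_ne_zero hn⟩⟩
  simp only [pBall, pnorm]
  rw [MeasureTheory.volume_sum_rpow_lt (Fin n) hp, MeasureTheory.volume_sum_rpow_le (Fin n) hp]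
  simp

lemma pnormLaw_Iic {n : ℕ} (hn : n ≠ 0) {p : ℝ} (hp : 1 ≤ p) {r : ℝ} (hr : r ≤ 1) :
    pnormLaw n p (Iic r) = ENNReal.ofReal r ^ n := by
  have h : {x : Fin n → ℝ | pnorm p x ∈ Iic r ∧ pnorm p x ≤ 1} = {x | pnorm p x ≤ r} := by
    ext x
    exact ⟨fun h => h.1, fun h => ⟨h, le_trans h hr⟩⟩
  rw [pnormLaw_apply n p measurableSet_Iic, h, volume_pnorm_le hn hp, mul_left_comm,
    ENNReal.inv_mul_cancel (volume_pBall_ne_zero hn hp) (volume_pBall_ne_top hn hp), mul_one]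

lemma pnormLaw_Iio {n : ℕ} (hn : n ≠ 0) {p : ℝ} (hp : 1 ≤ p) {r : ℝ} (hr : r ≤ 1) :
    pnormLaw n p (Iio r) = ENNReal.ofReal r ^ n := by
  have h : {x : Fin n → ℝ | pnorm p x ∈ Iio r ∧ pnorm p x ≤ 1} = {x | pnorm p x < r} := by
    ext x
    exact ⟨fun h => h.1, fun h => ⟨h, (lt_of_lt_of_le h hr).le⟩⟩
  rw [pnormLaw_apply n p measurableSet_Iio, h, volume_pnorm_lt hn hp, mul_left_comm,
    ENNReal.inv_mul_cancel (volume_pBall_ne_zero hn hp) (volume_pBall_ne_top hn hp), mul_one]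

lemma pnormLaw_Ioi_one (n : ℕ) (p : ℝ) : pnormLaw n p (Ioi 1) = 0 := by
  have h : {x : Fin n → ℝ | pnorm p x ∈ Ioi 1 ∧ pnorm p x ≤ 1} = ∅ := by
    ext x
    simp
  rw [pnormLaw_apply n p measurableSet_Ioi, h, measure_empty, mul_zero]

lemma pnormLaw_le_pow {n : ℕ} (hn : n ≠ 0) {p : ℝ} (hp : 1 ≤ p) {r : ℝ} (hr : r ≤ 1)
    {A : Set ℝ} (hA : A ⊆ Iic r ∪ Ioi 1) : pnormLaw n p A ≤ ENNReal.ofReal r ^ n :=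
  calc pnormLaw n p A ≤ pnormLaw n p (Iic r) + pnormLaw n p (Ioi 1) :=
        (measure_mono hA).trans (measure_union_le _ _)
    _ = ENNReal.ofReal r ^ n := by rw [pnormLaw_Iic hn hp hr, pnormLaw_Ioi_one, add_zero]

lemma le_pnormLaw {n : ℕ} (hn : n ≠ 0) {p : ℝ} (hp : 1 ≤ p) {a x : ℝ} (ha : 0 ≤ a)
    (hx : 0 < x) (hax : a < x) (hx1 : x ≤ 1) {A : Set ℝ} (hA : Ioo a x ⊆ A) :
    ENNReal.ofReal (x ^ n * (1 - a / x)) ≤ pnormLaw n p A := by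
  have hsub : Iio x ⊆ Iic a ∪ Ioo a x := by
    intro y hy
    rcases le_or_gt y a with h | h
    · exact Or.inl h
    · exact Or.inr ⟨h, hy⟩
  have h1 : ENNReal.ofReal x ^ n ≤ ENNReal.ofReal a ^ n + pnormLaw n p A := by
    rw [← pnormLaw_Iio hn hp hx1, ← pnormLaw_Iic hn hp (hax.le.trans hx1)]
    exact (measure_mono hsub).trans ((measure_union_le _ _).trans
      (add_le_add le_rfl (measure_mono hA)))
  rw [← ENNReal.ofReal_pow hx.le, ← ENNReal.ofReal_pow ha] at h1
  refine le_trans ?_ (tsub_le_iff_left.2 h1)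
  rw [← ENNReal.ofReal_sub _ (pow_nonneg ha n)]
  apply ENNReal.ofReal_le_ofReal
  have h2 : (a / x) ^ n ≤ a / x :=
    pow_le_of_le_one (div_nonneg ha hx.le) ((div_le_one hx).2 hax.le) hn
  have h3 : a ^ n = x ^ n * (a / x) ^ n := by
    rw [← mul_pow, mul_div_cancel₀ _ hx.ne']
  rw [h3, mul_sub, mul_one]
  gcongr

lemma coe_mul_log_ofReal (c : ℝ) {y : ℝ} (hy : 0 < y) :
    (c : EReal) * ENNReal.log (ENNReal.ofReal y) = ((c * Real.log y : ℝ) : EReal) := by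
  rw [ENNReal.log_ofReal_of_pos hy, EReal.coe_mul]

lemma neg_coe_ofReal_neg_log {x : ℝ} (hx : x ∈ Ioc (0 : ℝ) 1) :
    -((ENNReal.ofReal (-Real.log x) : ℝ≥0∞) : EReal) = ((Real.log x : ℝ) : EReal) := by
  have h : 0 ≤ -Real.log x := neg_nonneg.2 (Real.log_nonpos hx.1.le hx.2)
  rw [EReal.coe_ennreal_ofReal, max_eq_left h, ← EReal.coe_neg, neg_neg]

lemma log_le_liminf_pnormLaw {p : ℝ} (hp : 1 ≤ p) {A : Set ℝ} {x : ℝ}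
    (hx : x ∈ Ioc (0 : ℝ) 1) (hxA : x ∈ interior A) :
    ((Real.log x : ℝ) : EReal) ≤
      liminf (fun n : ℕ => (((n : ℝ)⁻¹ : ℝ) : EReal) * ENNReal.log (pnormLaw n p A)) atTop := by
  obtain ⟨b, hb, hbA⟩ := exists_Ioc_subset_of_mem_nhds (mem_interior_iff_mem_nhds.1 hxA)
    ⟨x - 1, sub_one_lt x⟩
  have hax : max b 0 < x := max_lt hb hx.1
  have hA : Ioo (max b 0) x ⊆ A := fun y hy =>
    hbA ⟨(le_max_left b 0).trans_lt hy.1, hy.2.le⟩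
  set c := 1 - max b 0 / x with hc
  have hc0 : 0 < c := sub_pos.2 ((div_lt_one hx.1).2 hax)
  have hlim : Tendsto (fun n : ℕ => ((Real.log x + (n : ℝ)⁻¹ * Real.log c : ℝ) : EReal)) atTop
      (𝓝 ((Real.log x : ℝ) : EReal)) := by
    apply (continuous_coe_real_ereal.tendsto _).comp
    have := (tendsto_inv_atTop_nhds_zero_nat (𝕜 := ℝ)).mul_const (Real.log c)
    simpa using this.const_add (Real.log x)
  rw [← hlim.liminf_eq]
  refine liminf_le_liminf ?_
  filter_upwards [eventually_ne_atTop 0] with n hn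
  have hn' : (n : ℝ) ≠ 0 := Nat.cast_ne_zero.2 hn
  have hpow : 0 < x ^ n := pow_pos hx.1 n
  have h : Real.log x + (n : ℝ)⁻¹ * Real.log c = (n : ℝ)⁻¹ * Real.log (x ^ n * c) := by
    rw [Real.log_mul hpow.ne' hc0.ne', Real.log_pow]
    field_simp
  rw [h, ← coe_mul_log_ofReal _ (mul_pos hpow hc0)]
  exact mul_le_mul_of_nonneg_left
    (ENNReal.log_monotone (le_pnormLaw hn hp (le_max_right b 0) hx.1 hax hx.2 hA))
    (EReal.coe_nonneg.2 (by positivity))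

lemma limsup_pnormLaw_le_log {p : ℝ} (hp : 1 ≤ p) {A : Set ℝ} {r : ℝ}
    (hr : r ∈ Ioc (0 : ℝ) 1) (hA : A ⊆ Iic r ∪ Ioi 1) :
    limsup (fun n : ℕ => (((n : ℝ)⁻¹ : ℝ) : EReal) * ENNReal.log (pnormLaw n p A)) atTop ≤
      ((Real.log r : ℝ) : EReal) := by
  refine limsup_le_of_le (h := ?_)
  filter_upwards [eventually_ne_atTop 0] with n hn
  have hn' : (n : ℝ) ≠ 0 := Nat.cast_ne_zero.2 hn
  have h : Real.log r = (n : ℝ)⁻¹ * Real.log (r ^ n) := by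
    rw [Real.log_pow]
    field_simp
  rw [h, ← coe_mul_log_ofReal _ (pow_pos hr.1 n), ENNReal.ofReal_pow hr.1.le]
  exact mul_le_mul_of_nonneg_left (ENNReal.log_monotone (pnormLaw_le_pow hn hp hr.2 hA))
    (EReal.coe_nonneg.2 (by positivity))

lemma limsup_pnormLaw_eq_bot {p : ℝ} (hp : 1 ≤ p) {A : Set ℝ} (hA : A ⊆ Iic 0 ∪ Ioi 1) :
    limsup (fun n : ℕ => (((n : ℝ)⁻¹ : ℝ) : EReal) * ENNReal.log (pnormLaw n p A)) atTop =
      ⊥ := by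
  rw [eq_bot_iff]
  refine limsup_le_of_le (h := ?_)
  filter_upwards [eventually_ne_atTop 0] with n hn
  have h : pnormLaw n p A = 0 := by
    simpa [hn] using pnormLaw_le_pow hn hp zero_le_one hA
  rw [h, ENNReal.log_zero, EReal.coe_mul_bot_of_pos (by positivity)]

lemma isCompact_sublevel_neg_log (c : ℝ≥0) :
    IsCompact {x : ℝ | (if x ∈ Ioc (0 : ℝ) 1 then ENNReal.ofReal (-Real.log x) else ⊤) ≤
      (c : ℝ≥0∞)} := by
  convert isCompact_Icc (a := Real.exp (-c)) (b := (1 : ℝ)) using 1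
  ext x
  simp only [mem_ofPred_eq, mem_Icc]
  split_ifs with h
  · rw [ENNReal.ofReal_le_coe, neg_le, Real.le_log_iff_exp_le h.1]
    exact ⟨fun hx => ⟨hx, h.2⟩, fun hx => hx.1⟩
  · simp only [top_le_iff, ENNReal.coe_ne_top, false_iff]
    exact fun hx => h ⟨(Real.exp_pos _).trans_le hx.1, hx.2⟩

/-- LDP for `‖X^{(n)}‖_p`, `X^{(n)} ~ ν_p^n`: speed `n` and good rate function
`I_1(x) = −log x` for `x ∈ (0,1]` and `I_1(x) = +∞` otherwise. -/
theorem ldp_pnorm_uniform_lp_ball (p : ℝ) (hp : 1 ≤ p) :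
    IsLDP
      (fun n => Measure.map (fun x => pnorm p x) (nuMeasure n p))
      (fun n => (n : ℝ))
      (fun x => if x ∈ Set.Ioc (0 : ℝ) 1 then ENNReal.ofReal (-Real.log x) else ⊤) := by
  refine ⟨isCompact_sublevel_neg_log, fun A _ => ⟨?_, ?_⟩⟩
  · rw [EReal.neg_le]
    have key : ∀ x ∈ interior A,
        -liminf (fun n : ℕ => (((n : ℝ)⁻¹ : ℝ) : EReal) * ENNReal.log (pnormLaw n p A)) atTop ≤
          (((if x ∈ Ioc (0 : ℝ) 1 then ENNReal.ofReal (-Real.log x) else ⊤ : ℝ≥0∞)) : EReal) := by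
      intro x hxA
      split_ifs with hx
      · rw [EReal.neg_le, neg_coe_ofReal_neg_log hx]
        exact log_le_liminf_pnormLaw hp hx hxA
      · simp
    refine ((le_max_right _ _).trans_eq EReal.coe_toENNReal_eq_max.symm).trans
      (EReal.coe_ennreal_le_coe_ennreal_iff.2 ?_)
    refine le_iInf₂ fun x hx => ?_
    exact (EReal.toENNReal_le_toENNReal (key x hx)).trans_eq EReal.toENNReal_coe
  · rcases (closure A ∩ Ioc (0 : ℝ) 1).eq_empty_or_nonempty with h | h
    · have hA : A ⊆ Iic 0 ∪ Ioi 1 := by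
        intro x hx
        by_contra hx'
        simp only [mem_union, mem_Iic, mem_Ioi, not_or, not_le, not_lt] at hx'
        exact (h ▸ ⟨subset_closure hx, hx'⟩ : x ∈ (∅ : Set ℝ))
      exact (limsup_pnormLaw_eq_bot hp hA).trans_le bot_le
    · have hbdd : BddAbove (closure A ∩ Ioc (0 : ℝ) 1) := ⟨1, fun x hx => hx.2.2⟩
      set r := sSup (closure A ∩ Ioc (0 : ℝ) 1)
      have hrA : r ∈ closure A :=
        closure_minimal inter_subset_left isClosed_closure (csSup_mem_closure h hbdd)
      have hr : r ∈ Ioc (0 : ℝ) 1 := by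
        obtain ⟨y, hy⟩ := h
        exact ⟨hy.2.1.trans_le (le_csSup hbdd hy), csSup_le ⟨y, hy⟩ fun x hx => hx.2.2⟩
      have hA : A ⊆ Iic r ∪ Ioi 1 := by
        intro x hx
        rcases lt_or_ge 1 x with h1 | h1
        · exact Or.inr h1
        · rcases le_or_gt x 0 with h0 | h0
          · exact Or.inl (h0.trans hr.1.le)
          · exact Or.inl (le_csSup hbdd ⟨subset_closure hx, h0, h1⟩)
      refine (limsup_pnormLaw_le_log hp hr hA).trans ?_
      rw [← neg_coe_ofReal_neg_log hr, EReal.neg_le_neg_iff, EReal.coe_ennreal_le_coe_ennreal_iff]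
      exact (iInf₂_le r hrA).trans_eq (if_pos hr)
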